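/- Let f : A → B be a p-homomorphism and g : A → B a q-homomorphism (p, q ∈ ℕ), and set h = f − g. Then for every a ∈ A one has R(g,a,z)·R(h,a,z) = R(f,a,z) in B[[z]]; consequently, for every a ∈ A the characteristic series R(h,a,z) can be written as a ratio P(z)/Q(z) where P(z) = R(f,a,z) is a polynomial of degree at most p and Q(z) = R(g,a,z) is a polynomial of degree at most q with Q(0) = 1, i.e. h is a p|q-homomorphism. -/

import Mathlib

noncomputable section

variable {A B : Type*}

/-- The Frobenius forms `Φ_k(f; a₁, …, a_k)`, defined inductively by `Φ₀ = 1`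
(so that `Φ₁(f; a) = f a`) and
`Φ_{k+1}(f; a₁, …, a_{k+1}) = f a₁ · Φ_k(f; a₂, …, a_{k+1})
  − Σ_{i=2}^{k+1} Φ_k(f; a₂, …, a₁·aᵢ, …, a_{k+1})`. -/
def Phi [CommRing A] [CommRing B] [Algebra ℝ A] [Algebra ℝ B]
    (f : A →ₗ[ℝ] B) : (n : ℕ) → (Fin n → A) → B
  | 0, _ => 1
  | n + 1, a =>
      f (a 0) * Phi f n (fun i => a i.succ) -
        ∑ i : Fin n, Phi f n (Function.update (fun j => a j.succ) i (a 0 * a i.succ))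

/-- `f : A → B` is an `n`-homomorphism in the sense of Buchstaber–Rees if
`f 1 = n · 1` and `Φ_{n+1}(f; a₁, …, a_{n+1}) = 0` for all arguments. -/
def IsNHom [CommRing A] [CommRing B] [Algebra ℝ A] [Algebra ℝ B]
    (n : ℕ) (f : A →ₗ[ℝ] B) : Prop :=
  f 1 = (n : B) ∧ ∀ a : Fin (n + 1) → A, Phi f (n + 1) a = 0

/-- The coefficients `ψ_k(f, a)` of the characteristic series, defined by `ψ₀ = 1` and,
for `k ≥ 1`, by the recursion `k·ψ_k(f,a) = Σ_{i=1}^{k} (−1)^{i−1} f(aⁱ)·ψ_{k−i}(f,a)`. -/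
def psi [CommRing A] [CommRing B] [Algebra ℝ A] [Algebra ℝ B]
    (f : A →ₗ[ℝ] B) (a : A) : ℕ → B
  | 0 => 1
  | k + 1 =>
      (((k : ℝ) + 1)⁻¹) • ∑ j ∈ Finset.range (k + 1),
        ((-1 : B) ^ j * f (a ^ (j + 1)) * psi f a (k - j))
  decreasing_by exact Nat.lt_succ_of_le (Nat.sub_le k j)

section PhiSymmetry

variable [CommRing A] [CommRing B] [Algebra ℝ A] [Algebra ℝ B] (f : A →ₗ[ℝ] B)

theorem Phi_cons {n : ℕ} (x : A) (v : Fin n → A) :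
    Phi f (n + 1) (Fin.cons x v : Fin (n + 1) → A) =
      f x * Phi f n v - ∑ i, Phi f n (Function.update v i (x * v i)) := by
  simp [Phi]

/-- The Frobenius forms are symmetric in their first two arguments. -/
theorem Phi_cons_cons_comm {n : ℕ} (x y : A) (v : Fin n → A) :
    Phi f (n + 2) (Fin.cons x (Fin.cons y v : Fin (n + 1) → A) : Fin (n + 2) → A) =
      Phi f (n + 2) (Fin.cons y (Fin.cons x v : Fin (n + 1) → A) : Fin (n + 2) → A) := by
  have hdouble : ∑ i, ∑ j, Phi f n (Function.update (Function.update v i (x * v i)) j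
        (y * Function.update v i (x * v i) j)) =
      ∑ i, ∑ j, Phi f n (Function.update (Function.update v i (y * v i)) j
        (x * Function.update v i (y * v i) j)) := by
    rw [Finset.sum_comm]
    refine Finset.sum_congr rfl fun i _ => Finset.sum_congr rfl fun j _ => ?_
    rcases eq_or_ne i j with rfl | h
    · simp [mul_left_comm]
    · rw [Function.update_of_ne h, Function.update_of_ne h.symm, Function.update_comm h]
  simp only [Phi_cons, Fin.sum_univ_succ, Fin.cons_zero, Fin.cons_succ, Fin.update_cons_zero,
    ← Fin.cons_update, Finset.sum_sub_distrib, ← Finset.mul_sum]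
  rw [hdouble, mul_comm y x]
  ring

/-- An argument of a Frobenius form may be moved to the front. -/
theorem Phi_insertNth {n : ℕ} (i : Fin (n + 1)) (x : A) (v : Fin n → A) :
    Phi f (n + 1) (i.insertNth x v : Fin (n + 1) → A) =
      Phi f (n + 1) (Fin.cons x v : Fin (n + 1) → A) := by
  induction n generalizing x with
  | zero => rw [Fin.fin_one_eq_zero i, Fin.insertNth_zero']
  | succ n ih =>
    cases i using Fin.cases with
    | zero => rw [Fin.insertNth_zero']
    | succ j =>
      obtain ⟨y, u, rfl⟩ : ∃ (y : A) (u : Fin n → A), v = (Fin.cons y u : Fin (n + 1) → A) :=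
        ⟨v 0, Fin.tail v, (Fin.cons_self_tail v).symm⟩
      have hins : (j.succ.insertNth x (Fin.cons y u : Fin (n + 1) → A) : Fin (n + 2) → A) =
          Fin.cons y (j.insertNth x u : Fin (n + 1) → A) := by
        rw [Fin.insertNth_eq_iff]
        constructor
        · simp
        · ext k
          cases k using Fin.cases <;> simp [Fin.removeNth]
      have hself (z : A) : Function.update (j.insertNth x u : Fin (n + 1) → A) j z =
          j.insertNth z u := by
        rw [Fin.eq_insertNth_iff]
        exact ⟨by simp, by ext k; simp [Fin.removeNth]⟩
      have hother (k : Fin n) (z : A) :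
          Function.update (j.insertNth x u : Fin (n + 1) → A) (j.succAbove k) z =
            j.insertNth x (Function.update u k z) := by
        rw [Fin.eq_insertNth_iff]
        refine ⟨by simp, ?_⟩
        ext l
        rcases eq_or_ne l k with rfl | h
        · simp [Fin.removeNth]
        · simp [Fin.removeNth, h]
      rw [hins, Phi_cons_cons_comm, Phi_cons, Phi_cons, ih, Fin.sum_univ_succAbove _ j,
        Fin.sum_univ_succ]
      simp only [Fin.insertNth_apply_same, Fin.insertNth_apply_succAbove, hself, hother, ih,
        Fin.cons_zero, Fin.cons_succ, Fin.update_cons_zero, ← Fin.cons_update]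

theorem Phi_update_const {n : ℕ} (i : Fin (n + 1)) (x a : A) :
    Phi f (n + 1) (Function.update (fun _ => a) i x) =
      Phi f (n + 1) (Fin.cons x (fun _ => a) : Fin (n + 1) → A) := by
  rw [← Phi_insertNth f i]
  congr 1
  rw [Fin.eq_insertNth_iff]
  exact ⟨by simp, by ext k; simp [Fin.removeNth]⟩

theorem Phi_eq_zero_of_le {n m : ℕ} (h : ∀ v : Fin n → A, Phi f n v = 0) (hnm : n ≤ m)
    (v : Fin m → A) : Phi f m v = 0 := by
  induction m, hnm using Nat.le_induction with
  | base => exact h v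
  | succ m _ ih => simp [Phi, ih]

end PhiSymmetry

section CharacteristicSeries

variable [CommRing A] [CommRing B] [Algebra ℝ A] [Algebra ℝ B] (f : A →ₗ[ℝ] B) (a : A)

theorem succ_mul_psi_succ (k : ℕ) :
    ((k : B) + 1) * psi f a (k + 1) =
      ∑ j ∈ Finset.range (k + 1), (-1 : B) ^ j * f (a ^ (j + 1)) * psi f a (k - j) := by
  have hk : ((k : B) + 1) = algebraMap ℝ B ((k : ℝ) + 1) := by simp
  rw [psi, hk, ← Algebra.smul_def, smul_inv_smul₀ (by positivity)]

theorem Phi_cons_pow_const (n : ℕ) :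
    Phi f n (fun _ => a) = (n.factorial : B) * psi f a n ∧
    ∀ m, Phi f (n + 1) (Fin.cons (a ^ m) (fun _ => a) : Fin (n + 1) → A) =
      (n.factorial : B) *
        ∑ j ∈ Finset.range (n + 1), (-1 : B) ^ j * f (a ^ (m + j)) * psi f a (n - j) := by
  induction n with
  | zero => simp [Phi, psi]
  | succ n ih =>
    have hdiag : Phi f (n + 1) (fun _ => a) = ((n + 1).factorial : B) * psi f a (n + 1) := by
      have hcons : (fun _ => a) = (Fin.cons (a ^ 1) (fun _ => a) : Fin (n + 1) → A) := by
        ext k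
        cases k using Fin.cases <;> simp
      rw [hcons, ih.2 1, Nat.factorial_succ]
      push_cast
      rw [mul_comm ((n : B) + 1), mul_assoc, succ_mul_psi_succ]
      simp only [add_comm 1]
    refine ⟨hdiag, fun m => ?_⟩
    rw [Phi_cons, hdiag]
    simp only [Phi_update_const, ← pow_succ, ih.2, Finset.sum_const, Finset.card_univ,
      Fintype.card_fin, nsmul_eq_mul]
    rw [Finset.sum_range_succ' _ (n + 1), Nat.factorial_succ]
    simp only [pow_succ, Nat.add_sub_add_right, add_assoc, add_comm 1]
    simp [Finset.sum_neg_distrib]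
    ring

theorem psi_eq_zero_of_isNHom {f : A →ₗ[ℝ] B} {n k : ℕ} (hf : IsNHom n f) (hk : n < k) :
    psi f a k = 0 := by
  have h := (Phi_cons_pow_const f a k).1
  rw [Phi_eq_zero_of_le f hf.2 hk] at h
  have hcast : (k.factorial : B) = algebraMap ℝ B (k.factorial : ℝ) := by simp
  rw [hcast, ← Algebra.smul_def] at h
  rw [← inv_smul_smul₀ (Nat.cast_ne_zero.2 k.factorial_ne_zero : (k.factorial : ℝ) ≠ 0)
    (psi f a k), ← h, smul_zero]

/-- The logarithmic derivative `∑ (-1)^j f(a^{j+1}) z^j` of the characteristic series. -/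
def charLogDeriv : PowerSeries B :=
  PowerSeries.mk fun j => (-1 : B) ^ j * f (a ^ (j + 1))

theorem derivative_mk_psi :
    PowerSeries.derivative B (PowerSeries.mk (psi f a)) =
      charLogDeriv f a * PowerSeries.mk (psi f a) := by
  ext k
  rw [PowerSeries.coeff_derivative, PowerSeries.coeff_mul,
    Finset.Nat.sum_antidiagonal_eq_sum_range_succ_mk]
  simp [charLogDeriv, mul_comm (psi f a (k + 1)), succ_mul_psi_succ]

/-- The characteristic series is determined by its logarithmic derivative and constant term. -/
theorem eq_mk_psi {F : PowerSeries B} (hF : PowerSeries.coeff 0 F = 1)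
    (hd : PowerSeries.derivative B F = charLogDeriv f a * F) :
    F = PowerSeries.mk (psi f a) := by
  ext k
  rw [PowerSeries.coeff_mk]
  induction k using Nat.strong_induction_on with
  | _ k ih =>
    cases k with
    | zero => rw [hF, psi]
    | succ k =>
      have h := congrArg (PowerSeries.coeff k) hd
      rw [PowerSeries.coeff_derivative, PowerSeries.coeff_mul,
        Finset.Nat.sum_antidiagonal_eq_sum_range_succ_mk] at h
      have hsum : PowerSeries.coeff (k + 1) F * ((k : B) + 1) =
          ((k : B) + 1) * psi f a (k + 1) := by
        rw [h, succ_mul_psi_succ]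
        refine Finset.sum_congr rfl fun j _ => ?_
        rw [ih (k - j) (by omega), charLogDeriv, PowerSeries.coeff_mk]
      have hk : ((k : B) + 1) = algebraMap ℝ B ((k : ℝ) + 1) := by simp
      rw [mul_comm, hk, ← Algebra.smul_def, ← Algebra.smul_def] at hsum
      exact (IsUnit.mk0 ((k : ℝ) + 1) (by positivity)).smul_left_cancel.1 hsum

theorem mk_psi_mul_mk_psi_sub (g : A →ₗ[ℝ] B) :
    PowerSeries.mk (psi g a) * PowerSeries.mk (psi (f - g) a) = PowerSeries.mk (psi f a) := by
  apply eq_mk_psi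
  · simp [PowerSeries.coeff_mul, psi]
  · have hlog : charLogDeriv f a = charLogDeriv g a + charLogDeriv (f - g) a := by
      ext k
      simp [charLogDeriv, mul_sub]
    rw [Derivation.leibniz, derivative_mk_psi, derivative_mk_psi, hlog, smul_eq_mul, smul_eq_mul]
    ring

theorem coe_trunc_mk_psi {f : A →ₗ[ℝ] B} {n : ℕ} (hf : IsNHom n f) :
    (PowerSeries.trunc (n + 1) (PowerSeries.mk (psi f a)) : PowerSeries B) =
      PowerSeries.mk (psi f a) := by
  ext k
  rw [Polynomial.coeff_coe, PowerSeries.coeff_trunc, PowerSeries.coeff_mk]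
  split_ifs with h
  · rfl
  · exact (psi_eq_zero_of_isNHom a hf (by omega)).symm

end CharacteristicSeries

/-- If `f` is a `p`-homomorphism and `g` a `q`-homomorphism, then for `h = f − g` one has
`R(g,a,z)·R(h,a,z) = R(f,a,z)`; consequently `R(h,a,z)` is a ratio of a polynomial of
degree at most `p` by a polynomial of degree at most `q` with constant term `1`, i.e.
`h` is a `p|q`-homomorphism. -/
theorem sub_isPQHom [CommRing A] [CommRing B] [Algebra ℝ A] [Algebra ℝ B]
    (p q : ℕ) (f g : A →ₗ[ℝ] B) (hf : IsNHom p f) (hg : IsNHom q g) (a : A) :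
    PowerSeries.mk (psi g a) * PowerSeries.mk (psi (f - g) a) = PowerSeries.mk (psi f a) ∧
      ∃ P Q : Polynomial B, P.natDegree ≤ p ∧ Q.natDegree ≤ q ∧ Q.coeff 0 = 1 ∧
        (Q : PowerSeries B) * PowerSeries.mk (psi (f - g) a) = (P : PowerSeries B) := by
  refine ⟨mk_psi_mul_mk_psi_sub f a g, PowerSeries.trunc (p + 1) (PowerSeries.mk (psi f a)),
    PowerSeries.trunc (q + 1) (PowerSeries.mk (psi g a)),
    Nat.lt_succ_iff.1 (PowerSeries.natDegree_trunc_lt _ p),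
    Nat.lt_succ_iff.1 (PowerSeries.natDegree_trunc_lt _ q), ?_, ?_⟩
  · simp [PowerSeries.coeff_trunc, psi]
  · rw [coe_trunc_mk_psi a hf, coe_trunc_mk_psi a hg, mk_psi_mul_mk_psi_sub]

end
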